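/- The twisted conformal algebra is a symmetry algebra of the difference-differential massless Klein–Gordon equation: for conformal weight ℓ = 1, if φ is smooth and □_z φ = 0, then □_z (X̂ φ) = 0 for each of the fifteen deformed operators X̂ ∈ {Ĵ_1,Ĵ_2,Ĵ_3, P̂_0,P̂_1,P̂_2,P̂_3, K̂_1,K̂_2,K̂_3, D̂, Ĉ_0,Ĉ_1,Ĉ_2,Ĉ_3} obtained by substituting p̂_μ for ∂_μ and x̂^μ for x^μ in the classical conformal formulas: Ĵ_i := Σ_{j,k} ε_{ijk} x̂^k p̂_j, P̂_μ := p̂_μ, K̂_i := −x̂^i p̂_0 − x̂^0 p̂_i, D̂ := −Σ_μ x̂^μ p̂_μ − 1, Ĉ_0 := (1/2)Q̂ p̂_0 − x̂^0(Σ_μ x̂^μ p̂_μ + 1), Ĉ_i := (1/2)Q̂ p̂_i + x̂^i(Σ_μ x̂^μ p̂_μ + 1), where Q̂ := (x̂^0)² − (x̂^1)² − (x̂^2)² − (x̂^3)² and □_z := p̂_0² − p̂_1² − p̂_2² − p̂_3². -/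

import Mathlib

noncomputable section

/-- Real-valued functions on `ℝ⁴` (encoded as `Fin 4 → ℝ`). -/
abbrev F : Type := (Fin 4 → ℝ) → ℝ

/-- Directional derivative `∂_μ` along the `μ`-th standard basis vector. -/
def pdf (μ : Fin 4) (φ : F) : F := fun x => fderiv ℝ φ x (Pi.single μ 1)

/-- Multiplication operator by the coordinate `x^μ`. -/
def mxf (μ : Fin 4) (φ : F) : F := fun x => x μ * φ x

/-- Translation operator `e^{a∂_μ}`: `(e^{a∂_μ}φ)(x) = φ(x + a e_μ)`. -/
def trf (a : ℝ) (μ : Fin 4) (φ : F) : F := fun x => φ (x + a • (Pi.single μ 1 : Fin 4 → ℝ))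

/-- `cosh(z∂_1) = (1/2)(e^{z∂_1} + e^{−z∂_1})`. -/
def chf (z : ℝ) (φ : F) : F := (1/2 : ℝ) • (trf z 1 φ + trf (-z) 1 φ)

/-- `sinh(z∂_1) = (1/2)(e^{z∂_1} − e^{−z∂_1})`. -/
def shf (z : ℝ) (φ : F) : F := (1/2 : ℝ) • (trf z 1 φ - trf (-z) 1 φ)

/-- Transverse Laplacian `∂_2² + ∂_3²`. -/
def lapT (φ : F) : F := pdf 2 (pdf 2 φ) + pdf 3 (pdf 3 φ)

/-- Deformed momentum `p̂_0`. -/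
def phat0 (z : ℝ) (φ : F) : F :=
  (1/z) • (φ - trf (-z) 0 (chf z φ)) - (z/2) • trf (-z) 0 (trf z 1 (lapT φ))
/-- Deformed momentum `p̂_1`. -/
def phat1 (z : ℝ) (φ : F) : F :=
  (1/z) • trf (-z) 0 (shf z φ) - (z/2) • trf (-z) 0 (trf z 1 (lapT φ))
/-- Deformed momentum `p̂_2`. -/
def phat2 (z : ℝ) (φ : F) : F := trf (-z) 0 (trf z 1 (pdf 2 φ))
/-- Deformed momentum `p̂_3`. -/
def phat3 (z : ℝ) (φ : F) : F := trf (-z) 0 (trf z 1 (pdf 3 φ))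
/-- The family `p̂_μ` of deformed momenta. -/
def phat (z : ℝ) : Fin 4 → F → F := ![phat0 z, phat1 z, phat2 z, phat3 z]

/-- Deformed position `x̂^0`. -/
def xhat0 (z : ℝ) (φ : F) : F :=
  mxf 0 (trf z 0 (chf z φ)) + mxf 1 (trf z 0 (shf z φ))
    + z • (mxf 2 (pdf 2 (trf z 0 (trf (-z) 1 φ))) + mxf 3 (pdf 3 (trf z 0 (trf (-z) 1 φ))))
    + (z^2/2) • (mxf 0 (trf z 0 (trf z 1 (lapT φ))) + mxf 1 (trf z 0 (trf z 1 (lapT φ))))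
/-- Deformed position `x̂^1`. -/
def xhat1 (z : ℝ) (φ : F) : F :=
  mxf 1 (trf z 0 (chf z φ)) + mxf 0 (trf z 0 (shf z φ))
    - z • (mxf 2 (pdf 2 (trf z 0 (trf (-z) 1 φ))) + mxf 3 (pdf 3 (trf z 0 (trf (-z) 1 φ))))
    - (z^2/2) • (mxf 0 (trf z 0 (trf z 1 (lapT φ))) + mxf 1 (trf z 0 (trf z 1 (lapT φ))))
/-- Deformed position `x̂^2`. -/
def xhat2 (z : ℝ) (φ : F) : F :=
  mxf 2 (trf z 0 (trf (-z) 1 φ))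
    + z • (mxf 0 (trf z 0 (trf z 1 (pdf 2 φ))) + mxf 1 (trf z 0 (trf z 1 (pdf 2 φ))))
/-- Deformed position `x̂^3`. -/
def xhat3 (z : ℝ) (φ : F) : F :=
  mxf 3 (trf z 0 (trf (-z) 1 φ))
    + z • (mxf 0 (trf z 0 (trf z 1 (pdf 3 φ))) + mxf 1 (trf z 0 (trf z 1 (pdf 3 φ))))
/-- The family `x̂^μ` of deformed positions. -/
def xhat (z : ℝ) : Fin 4 → F → F := ![xhat0 z, xhat1 z, xhat2 z, xhat3 z]

/-- Levi-Civita symbol with `ε_{123} = 1`, indices encoded as `Fin 3`. -/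
def eps (i j k : Fin 3) : ℝ :=
  ((j.val : ℝ) - (i.val : ℝ)) * ((k.val : ℝ) - (i.val : ℝ)) * ((k.val : ℝ) - (j.val : ℝ)) / 2

/-- The deformed d'Alembertian `□_z := p̂_0² − p̂_1² − p̂_2² − p̂_3²`. -/
def boxzC (z : ℝ) (φ : F) : F :=
  phat0 z (phat0 z φ) - phat1 z (phat1 z φ) - phat2 z (phat2 z φ) - phat3 z (phat3 z φ)

/-- Deformed rotations `Ĵ_i := Σ_{j,k} ε_{ijk} x̂^k p̂_j`. -/
def Jhat (z : ℝ) (i : Fin 3) (φ : F) : F :=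
  ∑ j : Fin 3, ∑ k : Fin 3, eps i j k • xhat z k.succ (phat z j.succ φ)
/-- Deformed boosts `K̂_i := −x̂^i p̂_0 − x̂^0 p̂_i`. -/
def Khat (z : ℝ) (i : Fin 3) (φ : F) : F :=
  -xhat z i.succ (phat z 0 φ) - xhat z 0 (phat z i.succ φ)
/-- `Σ_μ x̂^μ p̂_μ + 1` (conformal weight `ℓ = 1`). -/
def Ehat (z : ℝ) (φ : F) : F := (∑ μ : Fin 4, xhat z μ (phat z μ φ)) + φ
/-- Deformed dilation `D̂ := −Σ_μ x̂^μ p̂_μ − 1`. -/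
def Dhat (z : ℝ) (φ : F) : F := -(∑ μ : Fin 4, xhat z μ (phat z μ φ)) - φ
/-- `Q̂ := (x̂^0)² − (x̂^1)² − (x̂^2)² − (x̂^3)²`. -/
def Qhat (z : ℝ) (φ : F) : F :=
  xhat z 0 (xhat z 0 φ) - xhat z 1 (xhat z 1 φ) - xhat z 2 (xhat z 2 φ) - xhat z 3 (xhat z 3 φ)
/-- Deformed special conformal transformation `Ĉ_0`. -/
def C0hat (z : ℝ) (φ : F) : F := (1/2 : ℝ) • Qhat z (phat z 0 φ) - xhat z 0 (Ehat z φ)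
/-- Deformed special conformal transformations `Ĉ_i`. -/
def Cihat (z : ℝ) (i : Fin 3) (φ : F) : F :=
  (1/2 : ℝ) • Qhat z (phat z i.succ φ) + xhat z i.succ (Ehat z φ)

open scoped ContDiff

universe u

/-- The space of smooth functions on `ℝ⁴`. -/
def smoothFunctions : Submodule ℝ F where
  carrier := {φ | ContDiff ℝ ∞ φ}
  add_mem' {φ ψ} (hφ : ContDiff ℝ ∞ φ) (hψ : ContDiff ℝ ∞ ψ) := hφ.add hψ
  zero_mem' := (contDiff_const : ContDiff ℝ ∞ fun _ : Fin 4 → ℝ => (0 : ℝ))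
  smul_mem' c φ (hφ : ContDiff ℝ ∞ φ) := hφ.const_smul c

theorem contDiff_pdf (μ : Fin 4) {φ : F} (hφ : ContDiff ℝ ∞ φ) : ContDiff ℝ ∞ (pdf μ φ) :=
  (hφ.fderiv_right (m := ∞) (by norm_num)).clm_apply contDiff_const

theorem contDiff_mxf (μ : Fin 4) {φ : F} (hφ : ContDiff ℝ ∞ φ) : ContDiff ℝ ∞ (mxf μ φ) :=
  (contDiff_apply ℝ ℝ μ).mul hφ

theorem contDiff_trf (a : ℝ) (μ : Fin 4) {φ : F} (hφ : ContDiff ℝ ∞ φ) :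
    ContDiff ℝ ∞ (trf a μ φ) :=
  hφ.comp (contDiff_id.add contDiff_const)

theorem contDiff_coe (φ : smoothFunctions) : ContDiff ℝ ∞ (φ : F) := φ.2

theorem differentiable_coe (φ : smoothFunctions) : Differentiable ℝ (φ : F) :=
  (contDiff_coe φ).differentiable (by norm_num)

/-- Differentiation `∂_μ` of smooth functions. -/
def partialOp (μ : Fin 4) : Module.End ℝ smoothFunctions where
  toFun φ := ⟨pdf μ φ, contDiff_pdf μ φ.2⟩
  map_add' φ ψ := by
    ext x
    simp [pdf, fderiv_add (differentiable_coe φ x) (differentiable_coe ψ x)]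
  map_smul' c φ := by
    ext x
    simp [pdf, fderiv_const_smul (differentiable_coe φ x)]

/-- Multiplication of smooth functions by `x^μ`. -/
def coordOp (μ : Fin 4) : Module.End ℝ smoothFunctions where
  toFun φ := ⟨mxf μ φ, contDiff_mxf μ φ.2⟩
  map_add' φ ψ := by ext x; simp [mxf, mul_add]
  map_smul' c φ := by ext x; simp [mxf, mul_left_comm]

/-- Translation `e^{a∂_μ}` of smooth functions. -/
def shiftOp (a : ℝ) (μ : Fin 4) : Module.End ℝ smoothFunctions where
  toFun φ := ⟨trf a μ φ, contDiff_trf a μ φ.2⟩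
  map_add' φ ψ := by ext x; simp [trf]
  map_smul' c φ := by ext x; simp [trf]

theorem commute_partialOp (μ ν : Fin 4) : Commute (partialOp μ) (partialOp ν) := by
  ext φ x
  have h2 : ∀ μ ν : Fin 4, pdf μ (pdf ν φ) x =
      fderiv ℝ (fderiv ℝ (φ : F)) x (Pi.single μ 1) (Pi.single ν 1) := fun μ ν => by
    have hd : DifferentiableAt ℝ (fderiv ℝ (φ : F)) x :=
      ((contDiff_coe φ).fderiv_right (m := ∞) (by norm_num)).differentiable (by norm_num) x
    change fderiv ℝ (fun y => fderiv ℝ (φ : F) y (Pi.single ν 1)) x _ = _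
    rw [fderiv_clm_apply hd (differentiableAt_const _)]
    simp
  have hs : IsSymmSndFDerivAt ℝ (φ : F) x :=
    (contDiff_coe φ).contDiffAt.isSymmSndFDerivAt (by
      simpa using (WithTop.coe_le_coe.2 le_top : ((2 : ℕ∞) : WithTop ℕ∞) ≤ ∞))
  exact (h2 μ ν).trans ((hs _ _).trans (h2 ν μ).symm)

theorem commute_shiftOp (a b : ℝ) (μ ν : Fin 4) :
    Commute (shiftOp a μ) (shiftOp b ν) := by
  ext φ x
  exact congrArg (φ : F) (add_right_comm _ _ _)

theorem commute_partialOp_shiftOp (a : ℝ) (μ ν : Fin 4) :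
    Commute (partialOp μ) (shiftOp a ν) := by
  ext φ x
  change fderiv ℝ (fun y => (φ : F) (y + _)) x _ = fderiv ℝ (φ : F) _ _
  rw [fderiv_comp_add_right]

theorem shiftOp_mul_shiftOp_neg (a : ℝ) (μ : Fin 4) :
    shiftOp a μ * shiftOp (-a) μ = 1 := by
  ext φ x
  exact congrArg (φ : F) (by simp)

theorem partialOp_mul_coordOp (μ ν : Fin 4) :
    partialOp μ * coordOp ν = coordOp ν * partialOp μ + if μ = ν then 1 else 0 := by
  ext φ x
  have hx : HasFDerivAt (fun y : Fin 4 → ℝ => y ν) (ContinuousLinearMap.proj (R := ℝ) ν) x :=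
    hasFDerivAt_apply ν x
  have h : pdf μ (mxf ν φ) x = x ν * pdf μ φ x + (φ : F) x * (Pi.single μ 1 : Fin 4 → ℝ) ν := by
    change fderiv ℝ ((fun y => y ν) * (φ : F)) x _ = _
    rw [(hx.mul (differentiable_coe φ x).hasFDerivAt).fderiv]
    simp [pdf]
  refine h.trans ?_
  rcases eq_or_ne μ ν with rfl | hne
  · simp [coordOp, partialOp, mxf]
  · simp [coordOp, partialOp, mxf, hne, hne.symm]

theorem shiftOp_mul_coordOp (a : ℝ) (μ ν : Fin 4) :
    shiftOp a μ * coordOp ν =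
      coordOp ν * shiftOp a μ + (if μ = ν then a else 0) • shiftOp a μ := by
  ext φ x
  rcases eq_or_ne μ ν with rfl | hne
  · simp [shiftOp, coordOp, mxf, trf, add_mul]
  · simp [shiftOp, coordOp, mxf, trf, hne, hne.symm]

section Symbols

variable {R : Type*} [Ring R] [Algebra ℝ R]

/-- The deformed momenta in terms of `z` and of the operators `e^{-z∂_0}`, `e^{z∂_1}`, `e^{-z∂_1}`,
`∂_2` and `∂_3`, in this order. -/
def momentum (z : ℝ) (T' E E' d₂ d₃ : R) : Fin 4 → R :=
  ![(1/z) • (1 - T' * ((1/2 : ℝ) • (E + E'))) - (z/2) • (T' * (E * (d₂ * d₂ + d₃ * d₃))),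
    (1/z) • (T' * ((1/2 : ℝ) • (E - E'))) - (z/2) • (T' * (E * (d₂ * d₂ + d₃ * d₃))),
    T' * (E * d₂), T' * (E * d₃)]

/-- The matrix of partial derivatives of the deformed momenta with respect to `∂_0, …, ∂_3`. -/
def momentumJacobian (z : ℝ) (T' E E' d₂ d₃ : R) : Fin 4 → Fin 4 → R :=
  ![![(1/2 : ℝ) • (T' * (E + E')) + (z^2/2) • (T' * (E * (d₂ * d₂ + d₃ * d₃))),
      -(1/2 : ℝ) • (T' * (E - E')) - (z^2/2) • (T' * (E * (d₂ * d₂ + d₃ * d₃))),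
      -z • (T' * (E * d₂)), -z • (T' * (E * d₃))],
    ![-(1/2 : ℝ) • (T' * (E - E')) + (z^2/2) • (T' * (E * (d₂ * d₂ + d₃ * d₃))),
      (1/2 : ℝ) • (T' * (E + E')) - (z^2/2) • (T' * (E * (d₂ * d₂ + d₃ * d₃))),
      -z • (T' * (E * d₂)), -z • (T' * (E * d₃))],
    ![-z • (T' * (E * d₂)), z • (T' * (E * d₂)), T' * E, 0],
    ![-z • (T' * (E * d₃)), z • (T' * (E * d₃)), 0, T' * E]]

/-- The coefficient of `x^ρ` in the deformed position `x̂^ν`, at the entry `ρ ν`. -/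
def positionCoeff (z : ℝ) (T E E' d₂ d₃ : R) : Fin 4 → Fin 4 → R :=
  ![![T * ((1/2 : ℝ) • (E + E')) + (z^2/2) • (T * (E * (d₂ * d₂ + d₃ * d₃))),
      T * ((1/2 : ℝ) • (E - E')) - (z^2/2) • (T * (E * (d₂ * d₂ + d₃ * d₃))),
      z • (T * (E * d₂)), z • (T * (E * d₃))],
    ![T * ((1/2 : ℝ) • (E - E')) + (z^2/2) • (T * (E * (d₂ * d₂ + d₃ * d₃))),
      T * ((1/2 : ℝ) • (E + E')) - (z^2/2) • (T * (E * (d₂ * d₂ + d₃ * d₃))),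
      z • (T * (E * d₂)), z • (T * (E * d₃))],
    ![z • (d₂ * (T * E')), -z • (d₂ * (T * E')), T * E', 0],
    ![z • (d₃ * (T * E')), -z • (d₃ * (T * E')), 0, T * E']]

variable {R' : Type*} [Ring R'] [Algebra ℝ R']

theorem map_momentum (f : R →ₐ[ℝ] R') (z : ℝ) (T' E E' d₂ d₃ : R) (μ : Fin 4) :
    f (momentum z T' E E' d₂ d₃ μ) = momentum z (f T') (f E) (f E') (f d₂) (f d₃) μ := by
  fin_cases μ <;> simp [momentum]

theorem map_momentumJacobian (f : R →ₐ[ℝ] R') (z : ℝ) (T' E E' d₂ d₃ : R) (μ ρ : Fin 4) :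
    f (momentumJacobian z T' E E' d₂ d₃ μ ρ) =
      momentumJacobian z (f T') (f E) (f E') (f d₂) (f d₃) μ ρ := by
  fin_cases μ <;> fin_cases ρ <;> simp [momentumJacobian]

theorem map_positionCoeff (f : R →ₐ[ℝ] R') (z : ℝ) (T E E' d₂ d₃ : R) (ρ ν : Fin 4) :
    f (positionCoeff z T E E' d₂ d₃ ρ ν) =
      positionCoeff z (f T) (f E) (f E') (f d₂) (f d₃) ρ ν := by
  fin_cases ρ <;> fin_cases ν <;> simp [positionCoeff]

end Symbols

theorem momentumJacobian_mul_positionCoeff {R : Type*} [CommRing R] [Algebra ℝ R] (z : ℝ)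
    {T T' E E' : R} (d₂ d₃ : R) (hT : T * T' = 1) (hE : E * E' = 1) (μ ν : Fin 4) :
    ∑ ρ, momentumJacobian z T' E E' d₂ d₃ μ ρ * positionCoeff z T E E' d₂ d₃ ρ ν =
      if μ = ν then 1 else 0 := by
  have h2 : 2 * algebraMap ℝ R (1/2) = 1 := by
    rw [← map_ofNat (algebraMap ℝ R) 2, ← map_mul]; norm_num
  have hz : algebraMap ℝ R (z^2/2) = algebraMap ℝ R z ^ 2 * algebraMap ℝ R (1/2) := by
    rw [← map_pow, ← map_mul]; congr 1; ring
  rw [Fin.sum_univ_four]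
  fin_cases μ <;> fin_cases ν <;>
    simp [momentumJacobian, positionCoeff, Algebra.smul_def, -one_div, -map_div₀, hz] <;>
    generalize algebraMap ℝ R (1/2) = h at * <;>
    generalize algebraMap ℝ R z = w at * <;>
    grind

section Canonical

variable {A : Type*} [Ring A]

/-- The dilation `Σ_μ X^μ P_μ + 1`. -/
def dilation (P X : Fin 4 → A) : A := (∑ μ, X μ * P μ) + 1

theorem momentum_mul_dilation {P X : Fin 4 → A} (hP : ∀ μ ν, Commute (P μ) (P ν))
    (hX : ∀ μ ν, P μ * X ν = X ν * P μ + if μ = ν then 1 else 0) (ν : Fin 4) :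
    P ν * dilation P X = dilation P X * P ν + P ν := by
  have h : ∀ μ, P ν * (X μ * P μ) = X μ * P μ * P ν + if ν = μ then P μ else 0 := fun μ => by
    rw [← mul_assoc, hX, add_mul, mul_assoc, (hP ν μ).eq, ← mul_assoc]
    split_ifs <;> simp
  simp only [dilation, mul_add, add_mul, Finset.mul_sum, Finset.sum_mul, h,
    Finset.sum_add_distrib, mul_one, one_mul]
  simp

variable [Algebra ℝ A]

/-- The diagonal of the Minkowski metric. -/
def minkowski : Fin 4 → ℝ := ![1, -1, -1, -1]

theorem minkowski_mul_self (μ : Fin 4) : minkowski μ * minkowski μ = 1 := by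
  fin_cases μ <;> simp [minkowski]

/-- The d'Alembertian of a family of momenta. -/
def dAlembertian (P : Fin 4 → A) : A := ∑ μ, minkowski μ • (P μ * P μ)

/-- The Lorentz generator `g_νν X^μ P_ν - g_μμ X^ν P_μ`. -/
def lorentz (P X : Fin 4 → A) (μ ν : Fin 4) : A :=
  minkowski ν • (X μ * P ν) - minkowski μ • (X ν * P μ)

/-- The special conformal transformation
`½ (Σ_μ g_μμ X^μ X^μ) P_ν - g_νν X^ν (Σ_μ X^μ P_μ + 1)`. -/
def specialConformal (P X : Fin 4 → A) (ν : Fin 4) : A :=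
  (1/2 : ℝ) • ((∑ μ, minkowski μ • (X μ * X μ)) * P ν) - minkowski ν • (X ν * dilation P X)

variable {P X : Fin 4 → A}

theorem commute_dAlembertian (hP : ∀ μ ν, Commute (P μ) (P ν)) (ν : Fin 4) :
    Commute (dAlembertian P) (P ν) :=
  Commute.sum_left _ _ _ fun μ _ => ((hP μ ν).mul_left (hP μ ν)).smul_left _

theorem dAlembertian_mul_position
    (hX : ∀ μ ν, P μ * X ν = X ν * P μ + if μ = ν then 1 else 0) (ν : Fin 4) :
    dAlembertian P * X ν = X ν * dAlembertian P + (2 * minkowski ν) • P ν := by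
  have h : ∀ μ, minkowski μ • (P μ * P μ) * X ν =
      X ν * (minkowski μ • (P μ * P μ)) + if μ = ν then (2 * minkowski ν) • P ν else 0 := by
    intro μ
    rw [smul_mul_assoc, mul_assoc, hX, mul_add, ← mul_assoc, hX, mul_smul_comm, add_mul, mul_assoc]
    split_ifs with h
    · subst h
      simp only [one_mul, mul_one]
      module
    · simp
  simp only [dAlembertian, Finset.sum_mul, h, Finset.sum_add_distrib, Finset.mul_sum]
  simp

theorem dAlembertian_mul_dilation (hP : ∀ μ ν, Commute (P μ) (P ν))
    (hX : ∀ μ ν, P μ * X ν = X ν * P μ + if μ = ν then 1 else 0) :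
    dAlembertian P * dilation P X = (dilation P X + 2) * dAlembertian P := by
  have h : ∀ μ, dAlembertian P * (X μ * P μ) =
      X μ * P μ * dAlembertian P + (2 : ℝ) • (minkowski μ • (P μ * P μ)) := fun μ => by
    rw [← mul_assoc, dAlembertian_mul_position hX, add_mul, mul_assoc,
      (commute_dAlembertian hP μ).eq, ← mul_assoc, smul_mul_assoc, mul_smul]
  rw [dilation, mul_add, Finset.mul_sum, Finset.sum_congr rfl fun μ _ => h μ,
    Finset.sum_add_distrib, ← Finset.smul_sum, ← dAlembertian, ← Finset.sum_mul]
  rw [add_mul, add_mul, two_mul, two_smul]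
  simp only [mul_one, one_mul]
  abel

theorem dAlembertian_mul_neg_dilation (hP : ∀ μ ν, Commute (P μ) (P ν))
    (hX : ∀ μ ν, P μ * X ν = X ν * P μ + if μ = ν then 1 else 0) :
    dAlembertian P * -dilation P X = -(dilation P X + 2) * dAlembertian P := by
  rw [mul_neg, dAlembertian_mul_dilation hP hX, neg_mul]

theorem dAlembertian_mul_sq_position
    (hX : ∀ μ ν, P μ * X ν = X ν * P μ + if μ = ν then 1 else 0) :
    dAlembertian P * (∑ μ, minkowski μ • (X μ * X μ)) =
      (∑ μ, minkowski μ • (X μ * X μ)) * dAlembertian P + (4 : ℝ) • (dilation P X + 1) := by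
  have h : ∀ μ, dAlembertian P * (minkowski μ • (X μ * X μ)) =
      minkowski μ • (X μ * X μ) * dAlembertian P + ((4 : ℝ) • (X μ * P μ) + (2 : ℝ) • 1) :=
    fun μ => by
    have hg := minkowski_mul_self μ
    rw [mul_smul_comm, ← mul_assoc, dAlembertian_mul_position hX, add_mul, mul_assoc,
      dAlembertian_mul_position hX, smul_mul_assoc, hX, if_pos rfl, mul_add, ← mul_assoc,
      mul_smul_comm, smul_mul_assoc]
    match_scalars
    · ring
    · linear_combination 4 * hg
    · linear_combination 2 * hg
  simp only [Finset.mul_sum, h, Finset.sum_add_distrib, Finset.sum_mul, dilation,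
    ← Finset.smul_sum]
  simp only [Finset.sum_const, Finset.card_univ, Fintype.card_fin]
  module

theorem dAlembertian_mul_specialConformal (hP : ∀ μ ν, Commute (P μ) (P ν))
    (hX : ∀ μ ν, P μ * X ν = X ν * P μ + if μ = ν then 1 else 0) (ν : Fin 4) :
    dAlembertian P * specialConformal P X ν =
      (specialConformal P X ν - (2 * minkowski ν) • X ν) * dAlembertian P := by
  have hg := minkowski_mul_self ν
  have h₁ : dAlembertian P * ((∑ μ, minkowski μ • (X μ * X μ)) * P ν) =
      (∑ μ, minkowski μ • (X μ * X μ)) * P ν * dAlembertian P +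
        (4 : ℝ) • (P ν * dilation P X) := by
    rw [← mul_assoc, dAlembertian_mul_sq_position hX, momentum_mul_dilation hP hX, add_mul,
      mul_assoc, (commute_dAlembertian hP ν).eq, ← mul_assoc, smul_mul_assoc, add_mul, one_mul]
  have h₂ : dAlembertian P * (X ν * dilation P X) =
      X ν * dilation P X * dAlembertian P + (2 : ℝ) • (X ν * dAlembertian P) +
        (2 * minkowski ν) • (P ν * dilation P X) := by
    rw [← mul_assoc, dAlembertian_mul_position hX, add_mul, mul_assoc,
      dAlembertian_mul_dilation hP hX, smul_mul_assoc, add_mul, mul_add, two_mul, mul_add,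
      two_smul, ← mul_assoc]
  rw [specialConformal, mul_sub, sub_mul, sub_mul, mul_smul_comm, mul_smul_comm, h₁, h₂]
  simp only [smul_mul_assoc]
  match_scalars <;> first | ring1 | linear_combination (-2 : ℝ) * hg

theorem commute_dAlembertian_lorentz (hP : ∀ μ ν, Commute (P μ) (P ν))
    (hX : ∀ μ ν, P μ * X ν = X ν * P μ + if μ = ν then 1 else 0) (μ ν : Fin 4) :
    Commute (dAlembertian P) (lorentz P X μ ν) := by
  have h : ∀ μ ν, dAlembertian P * (X μ * P ν) =
      X μ * P ν * dAlembertian P + (2 * minkowski μ) • (P μ * P ν) := fun μ ν => by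
    rw [← mul_assoc, dAlembertian_mul_position hX, add_mul, mul_assoc,
      (commute_dAlembertian hP ν).eq, ← mul_assoc, smul_mul_assoc]
  rw [commute_iff_eq, lorentz, mul_sub, sub_mul, mul_smul_comm, mul_smul_comm, h, h, (hP ν μ).eq]
  simp only [smul_mul_assoc]
  module

end Canonical

theorem momentum_mul_position_variable {R : Type*} [Ring R] [Algebra ℝ R] {z : ℝ} (hz : z ≠ 0)
    {T' E E' d₂ d₃ x : R} {c : Fin 4 → ℝ} (hT' : T' * x = x * T' + (-z * c 0) • T')
    (hE : E * x = x * E + (z * c 1) • E) (hE' : E' * x = x * E' + (-z * c 1) • E')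
    (h₂ : d₂ * x = x * d₂ + c 2 • 1) (h₃ : d₃ * x = x * d₃ + c 3 • 1) (μ : Fin 4) :
    momentum z T' E E' d₂ d₃ μ * x =
      x * momentum z T' E E' d₂ d₃ μ + ∑ ρ, c ρ • momentumJacobian z T' E E' d₂ d₃ μ ρ := by
  have hT'_assoc (w : R) : T' * (x * w) = x * (T' * w) + (-z * c 0) • (T' * w) := by
    rw [← mul_assoc, hT', add_mul, mul_assoc, smul_mul_assoc]
  have hE_assoc (w : R) : E * (x * w) = x * (E * w) + (z * c 1) • (E * w) := by
    rw [← mul_assoc, hE, add_mul, mul_assoc, smul_mul_assoc]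
  have h₂_assoc (w : R) : d₂ * (x * w) = x * (d₂ * w) + c 2 • w := by
    rw [← mul_assoc, h₂, add_mul, mul_assoc, smul_mul_assoc, one_mul]
  have h₃_assoc (w : R) : d₃ * (x * w) = x * (d₃ * w) + c 3 • w := by
    rw [← mul_assoc, h₃, add_mul, mul_assoc, smul_mul_assoc, one_mul]
  rw [Fin.sum_univ_four]
  fin_cases μ <;>
    simp [momentum, momentumJacobian, mul_add, add_mul, mul_sub, sub_mul, mul_assoc, smul_sub,
      smul_add, -smul_eq_mul, hE, hE', h₂, h₃, hT'_assoc, hE_assoc, h₂_assoc, h₃_assoc] <;>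
    match_scalars <;> field_simp <;> ring

open scoped IsMulCommutative in
theorem exists_commRing_algHom {A : Type u} [Ring A] [Algebra ℝ A] {s : Set A}
    (hs : ∀ a ∈ s, ∀ b ∈ s, a * b = b * a) :
    ∃ (R : Type u) (_ : CommRing R) (_ : Algebra ℝ R) (f : R →ₐ[ℝ] A),
      Function.Injective f ∧ ∀ a ∈ s, ∃ r, f r = a := by
  have := Algebra.isMulCommutative_adjoin ℝ hs
  exact ⟨Algebra.adjoin ℝ s, inferInstance, inferInstance, (Algebra.adjoin ℝ s).val,
    Subtype.val_injective, fun a ha => ⟨⟨a, Algebra.subset_adjoin ha⟩, rfl⟩⟩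

/-- The deformed momenta as operators on smooth functions. -/
def momentumOp (z : ℝ) : Fin 4 → Module.End ℝ smoothFunctions :=
  momentum z (shiftOp (-z) 0) (shiftOp z 1) (shiftOp (-z) 1) (partialOp 2) (partialOp 3)

/-- The coefficient of `x^ρ` in the deformed position operator `x̂^ν`, at the entry `ρ ν`. -/
def positionCoeffOp (z : ℝ) : Fin 4 → Fin 4 → Module.End ℝ smoothFunctions :=
  positionCoeff z (shiftOp z 0) (shiftOp z 1) (shiftOp (-z) 1) (partialOp 2) (partialOp 3)

/-- The deformed positions as operators on smooth functions. -/
def positionOp (z : ℝ) (ν : Fin 4) : Module.End ℝ smoothFunctions :=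
  ∑ ρ, coordOp ρ * positionCoeffOp z ρ ν

/-- The derivatives of the deformed momenta as operators on smooth functions. -/
def momentumJacobianOp (z : ℝ) : Fin 4 → Fin 4 → Module.End ℝ smoothFunctions :=
  momentumJacobian z (shiftOp (-z) 0) (shiftOp z 1) (shiftOp (-z) 1) (partialOp 2) (partialOp 3)

theorem constCoeff_relations (z : ℝ) :
    (∀ μ ν, Commute (momentumOp z μ) (momentumOp z ν)) ∧
    (∀ μ ρ ν, Commute (momentumOp z μ) (positionCoeffOp z ρ ν)) ∧
    ∀ μ ν, ∑ ρ, momentumJacobianOp z μ ρ * positionCoeffOp z ρ ν = if μ = ν then 1 else 0 := by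
  obtain ⟨R, _, _, f, hf, hs⟩ := exists_commRing_algHom
    (s := Set.range partialOp ∪ Set.range fun p : ℝ × Fin 4 => shiftOp p.1 p.2) <| by
      rintro _ (⟨μ, rfl⟩ | ⟨p, rfl⟩) _ (⟨ν, rfl⟩ | ⟨q, rfl⟩)
      · exact commute_partialOp μ ν
      · exact commute_partialOp_shiftOp _ _ _
      · exact (commute_partialOp_shiftOp _ _ _).symm
      · exact commute_shiftOp _ _ _ _
  have hd (μ : Fin 4) : ∃ r, f r = partialOp μ := hs _ (Or.inl ⟨μ, rfl⟩)
  have ht (a : ℝ) (μ : Fin 4) : ∃ r, f r = shiftOp a μ := hs _ (Or.inr ⟨(a, μ), rfl⟩)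
  choose d hd using hd
  choose t ht using ht
  have htt (a : ℝ) (μ : Fin 4) : t a μ * t (-a) μ = 1 :=
    hf (by rw [map_mul, map_one, ht, ht, shiftOp_mul_shiftOp_neg])
  have hP (μ : Fin 4) : momentumOp z μ =
      f (momentum z (t (-z) 0) (t z 1) (t (-z) 1) (d 2) (d 3) μ) := by
    have h := map_momentum (R' := Module.End ℝ smoothFunctions) f z
      (t (-z) 0) (t z 1) (t (-z) 1) (d 2) (d 3) μ
    rw [hd, hd, ht, ht, ht] at h
    exact h.symm
  have hJ (μ ρ : Fin 4) : momentumJacobianOp z μ ρ =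
      f (momentumJacobian z (t (-z) 0) (t z 1) (t (-z) 1) (d 2) (d 3) μ ρ) := by
    have h := map_momentumJacobian (R' := Module.End ℝ smoothFunctions) f z
      (t (-z) 0) (t z 1) (t (-z) 1) (d 2) (d 3) μ ρ
    rw [hd, hd, ht, ht, ht] at h
    exact h.symm
  have hC (ρ ν : Fin 4) : positionCoeffOp z ρ ν =
      f (positionCoeff z (t z 0) (t z 1) (t (-z) 1) (d 2) (d 3) ρ ν) := by
    have h := map_positionCoeff (R' := Module.End ℝ smoothFunctions) f z
      (t z 0) (t z 1) (t (-z) 1) (d 2) (d 3) ρ ν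
    rw [hd, hd, ht, ht, ht] at h
    exact h.symm
  refine ⟨fun μ ν => ?_, fun μ ρ ν => ?_, fun μ ν => ?_⟩
  · rw [hP, hP]
    exact (Commute.all _ _).map f
  · rw [hP, hC]
    exact (Commute.all _ _).map f
  · simp only [hJ, hC, ← map_mul, ← map_sum]
    rw [momentumJacobian_mul_positionCoeff z (d 2) (d 3) (htt z 0) (htt z 1)]
    split_ifs <;> simp

theorem momentumOp_mul_coordOp {z : ℝ} (hz : z ≠ 0) (μ ρ : Fin 4) :
    momentumOp z μ * coordOp ρ = coordOp ρ * momentumOp z μ + momentumJacobianOp z μ ρ := by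
  have hd (μ : Fin 4) : partialOp μ * coordOp ρ =
      coordOp ρ * partialOp μ + (Pi.single ρ 1 : Fin 4 → ℝ) μ • 1 := by
    rw [partialOp_mul_coordOp, Pi.single_apply]
    split_ifs <;> simp
  have ht (a : ℝ) (μ : Fin 4) : shiftOp a μ * coordOp ρ =
      coordOp ρ * shiftOp a μ + (a * (Pi.single ρ 1 : Fin 4 → ℝ) μ) • shiftOp a μ := by
    rw [shiftOp_mul_coordOp, Pi.single_apply]
    split_ifs <;> simp
  refine (momentum_mul_position_variable hz (ht (-z) 0) (ht z 1) (ht (-z) 1) (hd 2)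
    (hd 3) μ).trans ?_
  congr 1
  simp [Pi.single_apply, momentumJacobianOp]

theorem momentumOp_mul_positionOp {z : ℝ} (hz : z ≠ 0) (μ ν : Fin 4) :
    momentumOp z μ * positionOp z ν =
      positionOp z ν * momentumOp z μ + if μ = ν then 1 else 0 := by
  obtain ⟨-, hC, hJ⟩ := constCoeff_relations z
  rw [positionOp, ← hJ μ ν, Finset.mul_sum, Finset.sum_mul, ← Finset.sum_add_distrib]
  refine Finset.sum_congr rfl fun ρ _ => ?_
  rw [← mul_assoc, momentumOp_mul_coordOp hz, add_mul, mul_assoc, (hC μ ρ ν).eq, ← mul_assoc]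

theorem coe_momentumOp (z : ℝ) (μ : Fin 4) (φ : smoothFunctions) :
    (momentumOp z μ φ : F) = phat z μ φ := by
  fin_cases μ <;> rfl

theorem coe_positionOp (z : ℝ) (ν : Fin 4) (φ : smoothFunctions) :
    (positionOp z ν φ : F) = xhat z ν φ := by
  have h : (positionOp z ν φ : F) = fun x => ∑ ρ, x ρ * (positionCoeffOp z ρ ν φ : F) x := by
    ext x
    simp [positionOp, coordOp, mxf]
  rw [h]
  ext x
  rw [Fin.sum_univ_four]
  have hs (a c : ℝ) (μ : Fin 4) (ψ : F) : trf a μ (c • ψ) = c • trf a μ ψ := rfl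
  fin_cases ν <;>
    simp [hs, positionCoeffOp, positionCoeff, xhat, xhat0, xhat1, xhat2, xhat3, mxf, chf, shf,
      lapT, shiftOp, partialOp] <;>
    ring

theorem boxzC_coe (z : ℝ) (φ : smoothFunctions) :
    boxzC z φ = (dAlembertian (momentumOp z) φ : F) := by
  ext x
  have h (μ : Fin 4) : phat z μ (phat z μ φ) = (momentumOp z μ (momentumOp z μ φ) : F) := by
    rw [coe_momentumOp, coe_momentumOp]
  have h₀ := h 0
  have h₁ := h 1
  have h₂ := h 2
  have h₃ := h 3
  simp only [phat, Matrix.cons_val] at h₀ h₁ h₂ h₃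
  simp [boxzC, dAlembertian, Fin.sum_univ_four, minkowski, h₀, h₁, h₂, h₃]
  ring

theorem boxzC_eq_zero_of_mul_eq {z : ℝ} {φ : smoothFunctions} (h : boxzC z φ = 0)
    {B C : Module.End ℝ smoothFunctions}
    (hB : dAlembertian (momentumOp z) * B = C * dAlembertian (momentumOp z)) :
    boxzC z (B φ) = 0 := by
  have h' : dAlembertian (momentumOp z) φ = 0 := Subtype.ext (by rw [← boxzC_coe, h]; rfl)
  rw [boxzC_coe, ← Module.End.mul_apply, hB, Module.End.mul_apply, h', map_zero]
  rfl

theorem coe_positionOp_momentumOp (z : ℝ) (μ ν : Fin 4) (φ : smoothFunctions) :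
    ((positionOp z μ * momentumOp z ν) φ : F) = xhat z μ (phat z ν φ) := by
  rw [Module.End.mul_apply, coe_positionOp, coe_momentumOp]

theorem coe_lorentz (z : ℝ) (μ ν : Fin 4) (φ : smoothFunctions) :
    (lorentz (momentumOp z) (positionOp z) μ ν φ : F) =
      minkowski ν • xhat z μ (phat z ν φ) - minkowski μ • xhat z ν (phat z μ φ) := by
  rw [← coe_positionOp_momentumOp, ← coe_positionOp_momentumOp]
  rfl

theorem coe_dilation (z : ℝ) (φ : smoothFunctions) :
    (dilation (momentumOp z) (positionOp z) φ : F) = Ehat z φ := by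
  simp [dilation, Ehat, ← coe_positionOp_momentumOp]

theorem coe_specialConformal (z : ℝ) (ν : Fin 4) (φ : smoothFunctions) :
    (specialConformal (momentumOp z) (positionOp z) ν φ : F) =
      (1/2 : ℝ) • Qhat z (phat z ν φ) - minkowski ν • xhat z ν (Ehat z φ) := by
  rw [← coe_dilation, ← coe_positionOp]
  simp only [Qhat, ← coe_positionOp, ← coe_momentumOp]
  simp [specialConformal, Fin.sum_univ_four, minkowski, sub_eq_add_neg]

theorem Jhat_eq (z : ℝ) (i : Fin 3) (φ : F) :
    Jhat z i φ = xhat z (i + 2).succ (phat z (i + 1).succ φ) -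
      xhat z (i + 1).succ (phat z (i + 2).succ φ) := by
  fin_cases i <;> simp [Jhat, eps, Fin.sum_univ_three] <;> module

/-- For conformal weight `ℓ = 1`, the fifteen deformed conformal operators map solutions
of the difference-differential massless Klein--Gordon equation `□_z φ = 0` to solutions. -/
theorem twisted_so42_symmetry_of_deformed_KG (z : ℝ) (hz : z ≠ 0) (φ : F)
    (hφ : ContDiff ℝ (⊤ : ℕ∞) φ) (h : boxzC z φ = 0) :
    (∀ i : Fin 3, boxzC z (Jhat z i φ) = 0) ∧
    (∀ μ : Fin 4, boxzC z (phat z μ φ) = 0) ∧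
    (∀ i : Fin 3, boxzC z (Khat z i φ) = 0) ∧
    boxzC z (Dhat z φ) = 0 ∧
    boxzC z (C0hat z φ) = 0 ∧
    (∀ i : Fin 3, boxzC z (Cihat z i φ) = 0) := by
  lift φ to smoothFunctions using hφ
  have hP := (constCoeff_relations z).1
  have hX := momentumOp_mul_positionOp hz
  have hL (μ ν : Fin 4) : boxzC z
      (minkowski ν • xhat z μ (phat z ν φ) - minkowski μ • xhat z ν (phat z μ φ)) = 0 := by
    rw [← coe_lorentz]
    exact boxzC_eq_zero_of_mul_eq h (commute_dAlembertian_lorentz hP hX μ ν)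
  have hC (ν : Fin 4) : boxzC z
      ((1/2 : ℝ) • Qhat z (phat z ν φ) - minkowski ν • xhat z ν (Ehat z φ)) = 0 := by
    rw [← coe_specialConformal]
    exact boxzC_eq_zero_of_mul_eq h (dAlembertian_mul_specialConformal hP hX ν)
  have hg (i : Fin 3) : minkowski i.succ = -1 := by fin_cases i <;> rfl
  refine ⟨fun i => ?_, fun μ => ?_, fun i => ?_, ?_, ?_, fun i => ?_⟩
  · convert hL (i + 1).succ (i + 2).succ using 2
    rw [Jhat_eq, hg, hg]
    module
  · rw [← coe_momentumOp]
    exact boxzC_eq_zero_of_mul_eq h (commute_dAlembertian hP μ)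
  · convert hL 0 i.succ using 2
    rw [hg, show minkowski 0 = 1 from rfl, Khat]
    module
  · have hD : Dhat z φ = (-dilation (momentumOp z) (positionOp z) : Module.End ℝ _) φ := by
      rw [LinearMap.neg_apply, Submodule.coe_neg, coe_dilation, Ehat, neg_add']
      rfl
    rw [hD]
    exact boxzC_eq_zero_of_mul_eq h (dAlembertian_mul_neg_dilation hP hX)
  · simpa [C0hat, minkowski] using hC 0
  · simpa [Cihat, hg] using hC i.succ
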